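/- Let D be an invertible self-adjoint operator with compact inverse Y = D^{-1}, Q_n as the spectral projections of Y summed as above, and suppose x is a bounded operator with ‖xD‖ ≤ C and ‖Dx‖ ≤ C (on dom D). Then ‖Q_n x Q_n‖ ≤ C‖Y‖ for all n, and for every ε > 0 there is N with ‖x − Q_n x Q_n‖ ≤ ε for all n ≥ N, uniformly over all such x. -/

import Mathlib

open scoped InnerProductSpace

open Filter Topology

/-- Composing a strongly null sequence of contractions with a compact operator gives a sequence
converging to zero in operator norm. -/
theorem IsCompactOperator.tendsto_norm_mul_zero {H : Type*} [NormedAddCommGroup H]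
    [InnerProductSpace ℂ H] {T : H →L[ℂ] H} (hT : IsCompactOperator T) {A : ℕ → H →L[ℂ] H}
    (hA : ∀ n, ‖A n‖ ≤ 1) (hA0 : ∀ y, Tendsto (fun n => A n y) atTop (𝓝 0)) :
    Tendsto (fun n => ‖A n * T‖) atTop (𝓝 0) := by
  rw [Metric.tendsto_atTop]
  intro ε hε
  obtain ⟨K, hK, hTK⟩ :=
    IsCompactOperator.image_closedBall_subset_compact (f := (T : H →ₗ[ℂ] H)) hT 1
  obtain ⟨t, ht, hcover⟩ := Metric.totallyBounded_iff.1 hK.totallyBounded (ε / 4) (by positivity)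
  have hev : ∀ᶠ n in atTop, ∀ y ∈ t, ‖A n y‖ < ε / 4 := by
    rw [ht.eventually_all]
    intro y _
    have := (hA0 y).norm
    rw [norm_zero] at this
    exact this.eventually_lt_const (by positivity)
  obtain ⟨N, hN⟩ := eventually_atTop.1 hev
  refine ⟨N, fun n hn => ?_⟩
  rw [dist_zero_right, norm_norm]
  refine lt_of_le_of_lt (ContinuousLinearMap.opNorm_le_of_unit_norm (C := ε / 2) (by positivity)
    fun z hz => ?_) (by linarith)
  have hmem : T z ∈ K := hTK ⟨z, by simp [hz], rfl⟩
  obtain ⟨y, hy, hzy⟩ := Set.mem_iUnion₂.1 (hcover hmem)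
  rw [Metric.mem_ball, dist_eq_norm] at hzy
  have h1 : ‖A n (T z - y)‖ ≤ ‖T z - y‖ := by
    simpa using (A n).le_of_opNorm_le (hA n) (T z - y)
  calc ‖(A n * T) z‖ = ‖A n (T z - y) + A n y‖ := by simp
    _ ≤ ‖A n (T z - y)‖ + ‖A n y‖ := norm_add_le _ _
    _ ≤ ε / 2 := by linarith [hN n hn y hy]

/-- A finite partial sum of the rank-one projections of an orthonormal family is a star
projection. -/
theorem Orthonormal.isStarProjection_of_apply_eq_sum {H ι : Type*} [NormedAddCommGroup H]
    [InnerProductSpace ℂ H] [CompleteSpace H] {e : ι → H} (he : Orthonormal ℂ e) (s : Finset ι)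
    {P : H →L[ℂ] H} (hP : ∀ x, P x = ∑ k ∈ s, ⟪e k, x⟫_ℂ • e k) : IsStarProjection P where
  isIdempotentElem := by
    have hPe : ∀ k ∈ s, P (e k) = e k := by
      classical
      intro k hk
      simp [hP, orthonormal_iff_ite.1 he, hk]
    ext x
    rw [mul_apply_eq_comp, hP x, map_sum]
    exact Finset.sum_congr rfl fun k hk => by rw [map_smul, hPe k hk]
  isSelfAdjoint := by
    rw [ContinuousLinearMap.isSelfAdjoint_iff_isSymmetric]
    intro x y
    simp only [ContinuousLinearMap.coe_coe, hP, sum_inner, inner_sum, inner_smul_left,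
      inner_smul_right, inner_conj_symm]
    exact Finset.sum_congr rfl fun k _ => mul_comm _ _

/-- Let `D` be an invertible self-adjoint operator with compact self-adjoint injective
inverse `Y = D⁻¹`, diagonalized by a Hilbert basis `(e_k)` with eigenvalues `γ_k ≠ 0`,
and let `Q_n` be the increasing finite rank spectral projections of `Y`.  Suppose `x` is
a bounded operator such that `x D` and `D x` are bounded by `C` on `dom D`; equivalently
`x = b Y = Y b'` with `‖b‖, ‖b'‖ ≤ C`.  Then `‖Q_n x Q_n‖ ≤ C ‖Y‖` for all `n`, and for
every `ε > 0` there is `N` (depending only on `ε`, `C` and `Y`, not on `x`) such that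
`‖x − Q_n x Q_n‖ ≤ ε` for all `n ≥ N`, uniformly over all such `x`. -/
theorem stmt15 {H : Type*} [NormedAddCommGroup H] [InnerProductSpace ℂ H]
    [CompleteSpace H]
    (Y : H →L[ℂ] H) (hYcpt : IsCompactOperator Y) (hYsa : IsSelfAdjoint Y)
    (hYinj : Function.Injective Y)
    (e : HilbertBasis ℕ ℂ H) (γ : ℕ → ℝ) (hγ : ∀ k, γ k ≠ 0)
    (heig : ∀ k, Y (e k) = ((γ k : ℂ)) • e k)
    (Q : ℕ → H →L[ℂ] H)
    (hQ : ∀ n x, Q n x = ∑ k ∈ Finset.range n, ⟪e k, x⟫_ℂ • e k)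
    (C : ℝ) (hC : 0 ≤ C) :
    (∀ x b b' : H →L[ℂ] H, ‖b‖ ≤ C → ‖b'‖ ≤ C → x = b * Y → x = Y * b' →
      ∀ n : ℕ, ‖Q n * x * Q n‖ ≤ C * ‖Y‖) ∧
    (∀ ε > (0 : ℝ), ∃ N : ℕ, ∀ n ≥ N,
      ∀ x b b' : H →L[ℂ] H, ‖b‖ ≤ C → ‖b'‖ ≤ C → x = b * Y → x = Y * b' →
        ‖x - Q n * x * Q n‖ ≤ ε) := by
  have hproj : ∀ n, IsStarProjection (Q n) := fun n =>
    e.orthonormal.isStarProjection_of_apply_eq_sum (Finset.range n) (hQ n)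
  have hQ1 : ∀ n, ‖Q n‖ ≤ 1 := fun n => (hproj n).norm_le
  refine ⟨fun x b b' hb _ hx _ n => ?_, fun ε hε => ?_⟩
  · calc ‖Q n * x * Q n‖ ≤ ‖Q n‖ * ‖x‖ * ‖Q n‖ := norm_mul₃_le
      _ ≤ 1 * ‖x‖ * 1 := by gcongr <;> exact hQ1 n
      _ = ‖b * Y‖ := by rw [one_mul, mul_one, hx]
      _ ≤ ‖b‖ * ‖Y‖ := norm_mul_le _ _
      _ ≤ C * ‖Y‖ := by gcongr
  have hstrong : ∀ y, Tendsto (fun n => (1 - Q n) y) atTop (𝓝 0) := by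
    intro y
    have h := (e.hasSum_repr y).tendsto_sum_nat.const_sub y
    simpa [hQ, e.repr_apply_apply] using h
  have hlim := (hYcpt.tendsto_norm_mul_zero (fun n => (hproj n).one_sub.norm_le) hstrong).const_mul
    (2 * C)
  rw [mul_zero] at hlim
  obtain ⟨N, hN⟩ := eventually_atTop.1 (hlim.eventually_le_const hε)
  refine ⟨N, fun n hn x b b' hb hb' hx hx' => ?_⟩
  have hadj : ‖Y * (1 - Q n)‖ = ‖(1 - Q n) * Y‖ := by
    rw [← norm_star (Y * (1 - Q n)), star_mul, hYsa.star_eq,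
      (hproj n).one_sub.isSelfAdjoint.star_eq]
  have hsplit : x - Q n * x * Q n = (1 - Q n) * Y * b' + Q n * (b * (Y * (1 - Q n))) := by
    rw [mul_assoc (1 - Q n), ← hx', ← mul_assoc b, ← hx]
    noncomm_ring
  calc ‖x - Q n * x * Q n‖
      ≤ ‖(1 - Q n) * Y * b'‖ + ‖Q n * (b * (Y * (1 - Q n)))‖ := hsplit ▸ norm_add_le _ _
    _ ≤ ‖(1 - Q n) * Y‖ * C + 1 * (C * ‖(1 - Q n) * Y‖) := by
      refine add_le_add (norm_mul_le_of_le le_rfl hb') (norm_mul_le_of_le (hQ1 n) ?_)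
      exact norm_mul_le_of_le hb hadj.le
    _ = 2 * C * ‖(1 - Q n) * Y‖ := by ring
    _ ≤ ε := hN n hn
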